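/- Let σ_X > 0, σ_R > 0, ρ ∈ (−1, 1), and let (X, R) be a bivariate Gaussian random vector with mean 0, Var(X) = σ_X², Var(R) = σ_R², and correlation ρ (i.e., E[XR] = ρσ_Xσ_R). Let S = X·R be the one-period strategy return. Then the Sharpe ratio of S satisfies SR(S) = E[S]/√(Var S) = ρ/√(1 + ρ²). -/

import Mathlib

open MeasureTheory Real

/-- The bivariate Gaussian measure on `ℝ × ℝ` with mean `0` and covariance matrix
`[[σX², ρ σX σR], [ρ σX σR, σR²]]`, given by its Lebesgue density.  The first
coordinate is the signal `X`, the second the return `R`. -/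
noncomputable def bivariateGaussian (σX σR ρ : ℝ) : Measure (ℝ × ℝ) :=
  volume.withDensity fun p =>
    ENNReal.ofReal ((2 * π * σX * σR * Real.sqrt (1 - ρ ^ 2))⁻¹ *
      Real.exp (-((p.1 / σX) ^ 2 - 2 * ρ * (p.1 / σX) * (p.2 / σR) + (p.2 / σR) ^ 2) /
        (2 * (1 - ρ ^ 2))))

open ProbabilityTheory

/-- The linear map sending a pair of independent standard Gaussians to a bivariate Gaussian
with standard deviations `σX`, `σR` and correlation `ρ`. -/
noncomputable def bivariateGaussianMap (σX σR ρ : ℝ) : ℝ × ℝ →ₗ[ℝ] ℝ × ℝ :=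
  Matrix.toLin (.finTwoProd ℝ) (.finTwoProd ℝ) !![σX, 0; σR * ρ, σR * √(1 - ρ ^ 2)]

lemma bivariateGaussianMap_apply (σX σR ρ : ℝ) (z : ℝ × ℝ) :
    bivariateGaussianMap σX σR ρ z =
      (σX * z.1, σR * ρ * z.1 + σR * √(1 - ρ ^ 2) * z.2) := by
  simp [bivariateGaussianMap, Matrix.toLin_finTwoProd_apply]

lemma det_bivariateGaussianMap (σX σR ρ : ℝ) :
    LinearMap.det (bivariateGaussianMap σX σR ρ) = σX * (σR * √(1 - ρ ^ 2)) := by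
  simp [bivariateGaussianMap, LinearMap.det_toLin, Matrix.det_fin_two]

lemma measurable_bivariateGaussianMap (σX σR ρ : ℝ) :
    Measurable (bivariateGaussianMap σX σR ρ) :=
  (LinearMap.continuous_of_finiteDimensional _).measurable

/-- A bivariate Gaussian measure is a linear image of the product of two standard Gaussians. -/
lemma bivariateGaussian_eq_map {σX σR ρ : ℝ} (hσX : 0 < σX) (hσR : 0 < σR)
    (h1 : -1 < ρ) (h2 : ρ < 1) :
    bivariateGaussian σX σR ρ =
      ((gaussianReal 0 1).prod (gaussianReal 0 1)).map (bivariateGaussianMap σX σR ρ) := by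
  have hρ : 0 < 1 - ρ ^ 2 := by nlinarith
  have hs : 0 < √(1 - ρ ^ 2) := Real.sqrt_pos.2 hρ
  have hdet : 0 < σX * (σR * √(1 - ρ ^ 2)) := by positivity
  have hL := measurable_bivariateGaussianMap σX σR ρ
  have hvol : (volume : Measure (ℝ × ℝ)) = ENNReal.ofReal (σX * (σR * √(1 - ρ ^ 2))) •
      (volume : Measure (ℝ × ℝ)).map (bivariateGaussianMap σX σR ρ) := by
    rw [Measure.map_linearMap_addHaar_eq_smul_addHaar _
      (by rw [det_bivariateGaussianMap]; exact hdet.ne'), det_bivariateGaussianMap, smul_smul,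
      abs_of_pos (inv_pos.2 hdet), ← ENNReal.ofReal_mul hdet.le, mul_inv_cancel₀ hdet.ne']
    simp
  refine Measure.ext_of_lintegral _ fun f hf ↦ ?_
  rw [lintegral_map hf hL, gaussianReal_of_var_ne_zero _ one_ne_zero,
    prod_withDensity (measurable_gaussianPDF _ _) (measurable_gaussianPDF _ _),
    lintegral_withDensity_eq_lintegral_mul _ (by fun_prop)
      (show Measurable fun z ↦ f (bivariateGaussianMap σX σR ρ z) from hf.comp hL),
    bivariateGaussian,
    lintegral_withDensity_eq_lintegral_mul _ (by fun_prop) hf, hvol, lintegral_smul_measure,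
    lintegral_map (by fun_prop) hL, smul_eq_mul, ← lintegral_const_mul _ (by fun_prop),
    ← Measure.volume_eq_prod]
  refine lintegral_congr fun z ↦ ?_
  rw [Pi.mul_apply, Pi.mul_apply, ← mul_assoc]
  congr 1
  rw [gaussianPDF, gaussianPDF, ← ENNReal.ofReal_mul hdet.le,
    ← ENNReal.ofReal_mul (gaussianPDFReal_nonneg _ _ _), bivariateGaussianMap_apply]
  congr 1
  have hexp : -((σX * z.1 / σX) ^ 2 - 2 * ρ * (σX * z.1 / σX) *
      ((σR * ρ * z.1 + σR * √(1 - ρ ^ 2) * z.2) / σR) +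
      ((σR * ρ * z.1 + σR * √(1 - ρ ^ 2) * z.2) / σR) ^ 2) / (2 * (1 - ρ ^ 2)) =
      -z.1 ^ 2 / 2 + -z.2 ^ 2 / 2 := by
    have hX : σX * z.1 / σX = z.1 := by field_simp
    have hR : (σR * ρ * z.1 + σR * √(1 - ρ ^ 2) * z.2) / σR = ρ * z.1 + √(1 - ρ ^ 2) * z.2 := by
      field_simp
    rw [hX, hR, div_eq_iff (by positivity)]
    linear_combination (-z.2 ^ 2) * Real.sq_sqrt hρ.le
  have hpi : √(2 * π) * √(2 * π) = 2 * π := Real.mul_self_sqrt (by positivity)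
  simp only [gaussianPDFReal, NNReal.coe_one, mul_one, sub_zero]
  rw [hexp, Real.exp_add]
  calc _ = (2 * π)⁻¹ * (rexp (-z.1 ^ 2 / 2) * rexp (-z.2 ^ 2 / 2)) := by field_simp
    _ = (√(2 * π) * √(2 * π))⁻¹ * (rexp (-z.1 ^ 2 / 2) * rexp (-z.2 ^ 2 / 2)) := by rw [hpi]
    _ = _ := by rw [mul_inv]; ring

lemma integral_bivariateGaussian {σX σR ρ : ℝ} (hσX : 0 < σX) (hσR : 0 < σR)
    (h1 : -1 < ρ) (h2 : ρ < 1) {f : ℝ × ℝ → ℝ} (hf : Measurable f) :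
    ∫ p, f p ∂bivariateGaussian σX σR ρ =
      ∫ z, f (σX * z.1, σR * ρ * z.1 + σR * √(1 - ρ ^ 2) * z.2)
        ∂(gaussianReal 0 1).prod (gaussianReal 0 1) := by
  rw [bivariateGaussian_eq_map hσX hσR h1 h2,
    integral_map (measurable_bivariateGaussianMap σX σR ρ).aemeasurable hf.aestronglyMeasurable]
  simp only [bivariateGaussianMap_apply]

lemma integrable_pow_gaussianReal (μ : ℝ) (v : NNReal) (n : ℕ) :
    Integrable (fun x ↦ x ^ n) (gaussianReal μ v) :=
  integrable_pow_of_mem_interior_integrableExpSet (X := id) (by simp) n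

lemma integral_sq_gaussianReal_zero_one : ∫ x, x ^ 2 ∂gaussianReal 0 1 = 1 := by
  have h := variance_fun_id_gaussianReal (μ := 0) (v := 1)
  rw [variance_eq_integral measurable_id'.aemeasurable] at h
  simpa using h

lemma integral_pow_four_gaussianReal_zero_one : ∫ x, x ^ 4 ∂gaussianReal 0 1 = 3 := by
  have hexp (t : ℝ) : HasDerivAt (fun t ↦ rexp (t ^ 2 / 2)) (t * rexp (t ^ 2 / 2)) t := by
    convert! ((hasDerivAt_pow 2 t).div_const 2).exp using 1
    simp; ring
  have hd {p : ℝ → ℝ} {p' t : ℝ} (hp : HasDerivAt p p' t) :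
      deriv (fun t ↦ p t * rexp (t ^ 2 / 2)) t = (p' + t * p t) * rexp (t ^ 2 / 2) := by
    rw [(hp.fun_mul (hexp t)).deriv]; ring
  calc ∫ x, x ^ 4 ∂gaussianReal 0 1
    _ = iteratedDeriv 4 (mgf (fun x ↦ x) (gaussianReal 0 1)) 0 := by
      rw [iteratedDeriv_mgf_zero] <;> simp
    _ = 3 := by
      have e1 : deriv (fun t ↦ rexp (t ^ 2 / 2)) = fun t ↦ t * rexp (t ^ 2 / 2) :=
        funext fun t ↦ (hexp t).deriv
      have e2 : deriv (fun t ↦ t * rexp (t ^ 2 / 2)) =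
          fun t ↦ (1 + t * t) * rexp (t ^ 2 / 2) :=
        funext fun t ↦ hd (hasDerivAt_id' t)
      have e3 : deriv (fun t ↦ (1 + t * t) * rexp (t ^ 2 / 2)) =
          fun t ↦ (3 * t + t ^ 3) * rexp (t ^ 2 / 2) := funext fun t ↦ by
        rw [hd (((hasDerivAt_id' t).fun_mul (hasDerivAt_id' t)).const_add 1)]; ring
      have e4 := hd (((hasDerivAt_id' (0 : ℝ)).const_mul 3).fun_add (hasDerivAt_pow 3 (0 : ℝ)))
      simp only [mgf_fun_id_gaussianReal, NNReal.coe_one, zero_mul, zero_add, one_mul,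
        iteratedDeriv_eq_iterate, Function.iterate_succ, Function.iterate_zero,
        Function.comp_apply, id, e1, e2, e3, e4]
      norm_num

/-- The mean of the product of two correlated combinations of independent standard Gaussians. -/
lemma integral_mul_prod_gaussianReal (a b : ℝ) :
    ∫ z : ℝ × ℝ, z.1 * (a * z.1 + b * z.2) ∂(gaussianReal 0 1).prod (gaussianReal 0 1) = a := by
  have i1 := (integrable_pow_gaussianReal 0 1 2).comp_fst (gaussianReal 0 1)
  have i2 := (integrable_pow_gaussianReal 0 1 1).mul_prod (integrable_pow_gaussianReal 0 1 1)
  calc _ = ∫ z : ℝ × ℝ, (a * z.1 ^ 2 + b * (z.1 ^ 1 * z.2 ^ 1))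
        ∂(gaussianReal 0 1).prod (gaussianReal 0 1) := by congr with z; ring
    _ = a := by
      rw [integral_add (i1.const_mul a) (i2.const_mul b), integral_const_mul, integral_const_mul,
        integral_fun_fst (fun x ↦ x ^ 2), integral_sq_gaussianReal_zero_one,
        integral_prod_mul (fun x : ℝ ↦ x ^ 1) (fun x : ℝ ↦ x ^ 1)]
      simp

lemma integral_sq_mul_prod_gaussianReal (a b : ℝ) :
    ∫ z : ℝ × ℝ, (z.1 * (a * z.1 + b * z.2) - a) ^ 2
      ∂(gaussianReal 0 1).prod (gaussianReal 0 1) = 2 * a ^ 2 + b ^ 2 := by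
  have ip := integrable_pow_gaussianReal 0 1
  have i0 : Integrable (fun x : ℝ ↦ a ^ 2 * x ^ 4 - 2 * a ^ 2 * x ^ 2) (gaussianReal 0 1) :=
    ((ip 4).const_mul _).sub ((ip 2).const_mul _)
  have i1 : Integrable (fun x : ℝ ↦ a ^ 2 * x ^ 4 - 2 * a ^ 2 * x ^ 2 + a ^ 2)
      (gaussianReal 0 1) := i0.add (integrable_const _)
  have i2 := (ip 2).mul_prod (ip 2)
  have i3 : Integrable (fun x : ℝ ↦ x ^ 3 - x ^ 1) (gaussianReal 0 1) := (ip 3).sub (ip 1)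
  have i4 := i3.mul_prod (ip 1)
  calc _ = ∫ z : ℝ × ℝ, ((a ^ 2 * z.1 ^ 4 - 2 * a ^ 2 * z.1 ^ 2 + a ^ 2) +
          b ^ 2 * (z.1 ^ 2 * z.2 ^ 2) + 2 * a * b * ((z.1 ^ 3 - z.1 ^ 1) * z.2 ^ 1))
        ∂(gaussianReal 0 1).prod (gaussianReal 0 1) := by congr with z; ring
    _ = (a ^ 2 * 3 - 2 * a ^ 2 * 1 + a ^ 2) + b ^ 2 * (1 * 1) + 2 * a * b * 0 := by
      rw [integral_add ((i1.comp_fst _).fun_add (i2.const_mul _)) (i4.const_mul _),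
        integral_add (i1.comp_fst _) (i2.const_mul _), integral_const_mul, integral_const_mul,
        integral_fun_fst (fun x ↦ a ^ 2 * x ^ 4 - 2 * a ^ 2 * x ^ 2 + a ^ 2),
        integral_prod_mul (fun x : ℝ ↦ x ^ 2) (fun x : ℝ ↦ x ^ 2),
        integral_prod_mul (fun x : ℝ ↦ x ^ 3 - x ^ 1) (fun x : ℝ ↦ x ^ 1),
        integral_add i0 (integrable_const _),
        integral_sub ((ip 4).const_mul _) ((ip 2).const_mul _), integral_const_mul,
        integral_const_mul, integral_sq_gaussianReal_zero_one,
        integral_pow_four_gaussianReal_zero_one]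
      simp
    _ = _ := by ring

/-- **Sharpe ratio of a one-period linear strategy.** For `(X, R)` centered bivariate
Gaussian with standard deviations `σX, σR > 0` and correlation `ρ ∈ (−1, 1)`, and
`S = X·R`, the Sharpe ratio satisfies `SR(S) = E[S]/√(Var S) = ρ/√(1 + ρ²)`. -/
theorem sharpeRatio_linear_strategy (σX σR ρ : ℝ) (hσX : 0 < σX) (hσR : 0 < σR)
    (h1 : -1 < ρ) (h2 : ρ < 1) :
    (∫ p : ℝ × ℝ, p.1 * p.2 ∂(bivariateGaussian σX σR ρ)) /
      Real.sqrt (∫ p : ℝ × ℝ,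
        (p.1 * p.2 - ∫ q : ℝ × ℝ, q.1 * q.2 ∂(bivariateGaussian σX σR ρ)) ^ 2
          ∂(bivariateGaussian σX σR ρ)) =
    ρ / Real.sqrt (1 + ρ ^ 2) := by
  have hρ : 0 ≤ 1 - ρ ^ 2 := by nlinarith
  have hσ : 0 < σX * σR := mul_pos hσX hσR
  have hmean : ∫ p : ℝ × ℝ, p.1 * p.2 ∂bivariateGaussian σX σR ρ = σX * σR * ρ := by
    rw [integral_bivariateGaussian hσX hσR h1 h2 (by fun_prop),
      ← integral_mul_prod_gaussianReal (σX * σR * ρ) (σX * σR * √(1 - ρ ^ 2))]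
    congr with z
    ring
  have hvar : ∫ p : ℝ × ℝ, (p.1 * p.2 - σX * σR * ρ) ^ 2 ∂bivariateGaussian σX σR ρ =
      (σX * σR) ^ 2 * (1 + ρ ^ 2) := by
    rw [integral_bivariateGaussian hσX hσR h1 h2 (by fun_prop)]
    calc _ = ∫ z : ℝ × ℝ, (z.1 * (σX * σR * ρ * z.1 + σX * σR * √(1 - ρ ^ 2) * z.2) -
            σX * σR * ρ) ^ 2 ∂(gaussianReal 0 1).prod (gaussianReal 0 1) := by
          congr with z
          ring
      _ = _ := by
          rw [integral_sq_mul_prod_gaussianReal]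
          linear_combination (σX * σR) ^ 2 * Real.sq_sqrt hρ
  rw [hmean, hvar, Real.sqrt_mul (sq_nonneg _), Real.sqrt_sq hσ.le,
    mul_div_mul_left _ _ hσ.ne']
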